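/- Let g ⊆ so(V) be a Lie subalgebra acting irreducibly on V with K(g,V) one-dimensional, and let T ≠ 0 in Λ³V satisfy T_X ∈ g for all X ∈ V. Then [T_X, T_Y] = T_{T_X Y} for all X,Y ∈ V (equivalently Ω^T = 0, so the bracket [X,Y] := T_X Y satisfies the Jacobi identity), and moreover g = {T_X : X ∈ V}. -/

import Mathlib

open scoped RealInnerProductSpace BigOperators

noncomputable section

variable {V : Type} [NormedAddCommGroup V] [InnerProductSpace ℝ V] [FiniteDimensional ℝ V]

/-- A skew-symmetric endomorphism of a real inner product space. -/
def IsSkew (A : V →ₗ[ℝ] V) : Prop := ∀ x y : V, ⟪A x, y⟫ = - ⟪x, A y⟫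

/-- Membership in `K(g,V)`: a `g`-valued algebraic curvature tensor, i.e. an
antisymmetric bilinear map `V × V → g` satisfying the first Bianchi identity. -/
def IsCurv (g : Submodule ℝ (V →ₗ[ℝ] V))
    (R : V →ₗ[ℝ] V →ₗ[ℝ] (V →ₗ[ℝ] V)) : Prop :=
  (∀ X Y : V, R X Y ∈ g) ∧
  (∀ X Y : V, R X Y = - R Y X) ∧
  (∀ X Y Z : V, R X Y Z + R Y Z X + R Z X Y = 0)


/-- Elements of the skew prolongation of `g`. -/
def InP (g : Submodule ℝ (V →ₗ[ℝ] V)) (U : V →ₗ[ℝ] V →ₗ[ℝ] V) : Prop :=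
  (∀ X, U X ∈ g) ∧ ∀ X Y, U X Y = - U Y X

theorem InP.self {g : Submodule ℝ (V →ₗ[ℝ] V)} {U : V →ₗ[ℝ] V →ₗ[ℝ] V} (h : InP g U) (X : V) :
    U X X = 0 := by
  have h1 := h.2 X X
  have h2 : (2 : ℝ) • U X X = 0 := by rw [two_smul]; nth_rewrite 1 [h1]; simp
  simpa using h2

theorem inP_of_self {g : Submodule ℝ (V →ₗ[ℝ] V)} {U : V →ₗ[ℝ] V →ₗ[ℝ] V} (h : ∀ X, U X ∈ g)
    (h0 : ∀ X, U X X = 0) : InP g U := by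
  refine ⟨h, fun X Y => ?_⟩
  have := h0 (X + Y)
  simp only [map_add, LinearMap.add_apply, h0, zero_add, add_zero] at this
  exact eq_neg_of_add_eq_zero_right this

/-- Derivation action of an endomorphism. -/
def act (A : V →ₗ[ℝ] V) (U : V →ₗ[ℝ] V →ₗ[ℝ] V) : V →ₗ[ℝ] V →ₗ[ℝ] V :=
  LinearMap.mk₂ ℝ (fun X Y => A (U X Y) - U X (A Y) - U (A X) Y)
    (by intros; simp only [map_add, LinearMap.add_apply]; abel)
    (by intros; simp only [map_smul, LinearMap.smul_apply]; module)
    (by intros; simp only [map_add]; abel)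
    (by intros; simp only [map_smul]; module)

theorem act_apply (A : V →ₗ[ℝ] V) (U : V →ₗ[ℝ] V →ₗ[ℝ] V) (X Y : V) :
    act A U X Y = A (U X Y) - U X (A Y) - U (A X) Y := rfl

theorem act_inP {g : Submodule ℝ (V →ₗ[ℝ] V)}
    (hgskew : ∀ A ∈ g, IsSkew A)
    (hglie : ∀ A ∈ g, ∀ B ∈ g, A ∘ₗ B - B ∘ₗ A ∈ g)
    {U : V →ₗ[ℝ] V →ₗ[ℝ] V} (h : InP g U) {A : V →ₗ[ℝ] V} (hA : A ∈ g) : InP g (act A U) := by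
  refine ⟨fun X => ?_, fun X Y => ?_⟩
  · have : act A U X = (A ∘ₗ U X - U X ∘ₗ A) - U (A X) := by
      ext Y; simp [act_apply]
    rw [this]
    exact g.sub_mem (hglie _ hA _ (h.1 X)) (h.1 _)
  · rw [act_apply, act_apply, h.2 X Y, h.2 X (A Y), h.2 (A X) Y, map_neg]; abel

/-- The curvature tensor built from `U`. -/
def curvU (U : V →ₗ[ℝ] V →ₗ[ℝ] V) : V →ₗ[ℝ] V →ₗ[ℝ] (V →ₗ[ℝ] V) :=
  LinearMap.mk₂ ℝ (fun X Y => U X ∘ₗ U Y - U Y ∘ₗ U X + (2 : ℝ) • U (U X Y))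
    (by intros; ext; simp only [map_add, LinearMap.add_apply, LinearMap.sub_apply,
          LinearMap.comp_apply, LinearMap.smul_apply]; module)
    (by intros; ext; simp only [map_smul, LinearMap.add_apply, LinearMap.sub_apply,
          LinearMap.comp_apply, LinearMap.smul_apply]; module)
    (by intros; ext; simp only [map_add, LinearMap.add_apply, LinearMap.sub_apply,
          LinearMap.comp_apply, LinearMap.smul_apply]; module)
    (by intros; ext; simp only [map_smul, LinearMap.add_apply, LinearMap.sub_apply,
          LinearMap.comp_apply, LinearMap.smul_apply]; module)

theorem curvU_apply (U : V →ₗ[ℝ] V →ₗ[ℝ] V) (X Y Z : V) :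
    curvU U X Y Z = U X (U Y Z) - U Y (U X Z) + (2 : ℝ) • U (U X Y) Z := rfl

theorem curvU_isCurv {g : Submodule ℝ (V →ₗ[ℝ] V)}
    (hglie : ∀ A ∈ g, ∀ B ∈ g, A ∘ₗ B - B ∘ₗ A ∈ g)
    {U : V →ₗ[ℝ] V →ₗ[ℝ] V} (h : InP g U) : IsCurv g (curvU U) := by
  refine ⟨fun X Y => ?_, fun X Y => ?_, fun X Y Z => ?_⟩
  · exact g.add_mem (hglie _ (h.1 X) _ (h.1 Y)) (g.smul_mem _ (h.1 _))
  · ext Z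
    rw [LinearMap.neg_apply, curvU_apply, curvU_apply, h.2 X Y, map_neg, LinearMap.neg_apply]
    module
  · rw [curvU_apply, curvU_apply, curvU_apply, h.2 (U X Y) Z, h.2 (U Y Z) X, h.2 (U Z X) Y,
      h.2 X Z, h.2 Y X, h.2 Z Y]
    simp only [map_neg]
    module

theorem curvU_zero {g : Submodule ℝ (V →ₗ[ℝ] V)} (hgskew : ∀ A ∈ g, IsSkew A)
    {U : V →ₗ[ℝ] V →ₗ[ℝ] V} (h : InP g U) (h0 : curvU U = 0) : U = 0 := by
  ext X Y
  have h1 : ⟪curvU U X Y Y, X⟫ = 0 := by rw [h0]; simp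
  rw [curvU_apply, h.self Y, map_zero, zero_sub, inner_add_left, inner_neg_left, inner_smul_left,
    hgskew _ (h.1 Y), h.2 (U X Y) Y, inner_neg_left, hgskew _ (h.1 Y), h.2 Y X, inner_neg_right]
    at h1
  simp only [conj_trivial] at h1
  have : ⟪U X Y, U X Y⟫ = 0 := by linarith
  simpa using this

theorem ker_R0 {g : Submodule ℝ (V →ₗ[ℝ] V)}
    (hglie : ∀ A ∈ g, ∀ B ∈ g, A ∘ₗ B - B ∘ₗ A ∈ g)
    (hirr : ∀ W : Submodule ℝ V, (∀ A ∈ g, ∀ x ∈ W, A x ∈ W) → W = ⊥ ∨ W = ⊤)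
    (R0 : V →ₗ[ℝ] V →ₗ[ℝ] (V →ₗ[ℝ] V)) (hR0 : IsCurv g R0) (hR0ne : R0 ≠ 0)
    (hKdim : ∀ R : V →ₗ[ℝ] V →ₗ[ℝ] (V →ₗ[ℝ] V), IsCurv g R → ∃ c : ℝ, R = c • R0)
    (Y : V) (hY : ∀ X, R0 X Y = 0) : Y = 0 := by
  let W : Submodule ℝ V := ⨅ X, LinearMap.ker (R0 X)
  have hW : ∀ Y, Y ∈ W ↔ ∀ X, R0 X Y = 0 := by intro Y; simp [W]
  have hinv : ∀ A ∈ g, ∀ x ∈ W, A x ∈ W := by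
    intro A hA Y hY
    rw [hW] at hY ⊢
    let R : V →ₗ[ℝ] V →ₗ[ℝ] (V →ₗ[ℝ] V) :=
      LinearMap.mk₂ ℝ (fun X Y => (A ∘ₗ R0 X Y - R0 X Y ∘ₗ A) - R0 (A X) Y - R0 X (A Y))
        (by intros; ext; simp only [map_add, LinearMap.add_apply, LinearMap.sub_apply,
              LinearMap.comp_apply]; abel)
        (by intros; ext; simp only [map_smul, LinearMap.sub_apply,
              LinearMap.comp_apply, LinearMap.smul_apply]; module)
        (by intros; ext; simp only [map_add, LinearMap.add_apply, LinearMap.sub_apply,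
              LinearMap.comp_apply]; abel)
        (by intros; ext; simp only [map_smul, LinearMap.sub_apply,
              LinearMap.comp_apply, LinearMap.smul_apply]; module)
    have hR : ∀ X Y, R X Y = (A ∘ₗ R0 X Y - R0 X Y ∘ₗ A) - R0 (A X) Y - R0 X (A Y) :=
      fun _ _ => rfl
    have hRC : IsCurv g R := by
      refine ⟨?_, ?_, ?_⟩
      · intro X Y
        rw [hR]
        exact g.sub_mem (g.sub_mem (hglie _ hA _ (hR0.1 _ _)) (hR0.1 _ _)) (hR0.1 _ _)
      · intro X Y
        rw [hR, hR, hR0.2.1 X Y, hR0.2.1 (A X) Y, hR0.2.1 X (A Y)]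
        ext Z
        simp only [LinearMap.sub_apply, LinearMap.neg_apply, LinearMap.comp_apply, map_neg]
        abel
      · intro X Y Z
        have e1 := congrArg A (hR0.2.2 X Y Z)
        have e2 := hR0.2.2 (A X) Y Z
        have e3 := hR0.2.2 X (A Y) Z
        have e4 := hR0.2.2 X Y (A Z)
        simp only [hR, LinearMap.sub_apply, LinearMap.comp_apply]
        simp only [map_add, map_zero] at e1
        have e5 : (A (R0 X Y Z) + A (R0 Y Z X) + A (R0 Z X Y))
            - (R0 (A X) Y Z + R0 Y Z (A X) + R0 Z (A X) Y)
            - (R0 X (A Y) Z + R0 (A Y) Z X + R0 Z X (A Y))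
            - (R0 X Y (A Z) + R0 Y (A Z) X + R0 (A Z) X Y) = 0 := by
          rw [e1, e2, e3, e4]; simp
        rw [← e5]; abel
    obtain ⟨c, hc⟩ := hKdim R hRC
    intro X
    have := hR X Y
    rw [hc] at this
    simpa [hY] using this
  rcases hirr W hinv with h | h
  · have : Y ∈ W := (hW Y).2 hY
    rw [h] at this
    simpa using this
  · exfalso
    apply hR0ne
    refine LinearMap.ext fun X => LinearMap.ext fun Y => ?_
    exact (hW Y).1 (by rw [h]; trivial) X

theorem jac {g : Submodule ℝ (V →ₗ[ℝ] V)}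
    (hgskew : ∀ A ∈ g, IsSkew A)
    (hglie : ∀ A ∈ g, ∀ B ∈ g, A ∘ₗ B - B ∘ₗ A ∈ g)
    (hirr : ∀ W : Submodule ℝ V, (∀ A ∈ g, ∀ x ∈ W, A x ∈ W) → W = ⊥ ∨ W = ⊤)
    (R0 : V →ₗ[ℝ] V →ₗ[ℝ] (V →ₗ[ℝ] V)) (hR0 : IsCurv g R0) (hR0ne : R0 ≠ 0)
    (hKdim : ∀ R : V →ₗ[ℝ] V →ₗ[ℝ] (V →ₗ[ℝ] V), IsCurv g R → ∃ c : ℝ, R = c • R0)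
    {U : V →ₗ[ℝ] V →ₗ[ℝ] V} (h : InP g U) (W X Y : V) :
    U W (U X Y) - U X (U W Y) = U (U W X) Y := by
  have hS := act_inP hgskew hglie h (h.1 W)
  have hSW : act (U W) U W = 0 := by
    ext Y; simp [act_apply, h.self]
  have hS0 : act (U W) U = 0 := by
    by_cases hW : W = 0
    · subst hW; ext; simp [act_apply]
    apply curvU_zero hgskew hS
    obtain ⟨c, hc⟩ := hKdim _ (curvU_isCurv hglie hS)
    by_cases hc0 : c = 0
    · rw [hc, hc0, zero_smul]
    exfalso
    apply hW
    apply ker_R0 hglie hirr R0 hR0 hR0ne hKdim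
    intro X
    have h1 : curvU (act (U W) U) X W = 0 := by
      ext Z
      rw [curvU_apply, hS.2 X W, hSW]
      simp
    rw [hc] at h1
    simpa [hc0] using h1
  have := act_apply (U W) U X Y
  rw [hS0] at this
  simp only [LinearMap.zero_apply] at this
  rw [eq_comm, sub_eq_zero] at this
  exact this

theorem trace_skew {A : V →ₗ[ℝ] V} (hA : IsSkew A)
    (h : LinearMap.trace ℝ V (A ∘ₗ A) = 0) : A = 0 := by
  let b := stdOrthonormalBasis ℝ V
  rw [LinearMap.trace_eq_sum_inner _ b] at h
  have h2 : ∑ i, ⟪A (b i), A (b i)⟫ = 0 := by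
    rw [← neg_eq_zero, ← Finset.sum_neg_distrib, ← h]
    refine Finset.sum_congr rfl fun i _ => ?_
    rw [hA, neg_neg, LinearMap.comp_apply]
  rw [Finset.sum_eq_zero_iff_of_nonneg (fun i _ => real_inner_self_nonneg)] at h2
  refine b.toBasis.ext fun i => ?_
  simpa using h2 i (Finset.mem_univ i)

theorem stmt_10
    (g : Submodule ℝ (V →ₗ[ℝ] V))
    (hgskew : ∀ A ∈ g, IsSkew A)
    (hglie : ∀ A ∈ g, ∀ B ∈ g, A ∘ₗ B - B ∘ₗ A ∈ g)
    (hirr : ∀ W : Submodule ℝ V, (∀ A ∈ g, ∀ x ∈ W, A x ∈ W) → W = ⊥ ∨ W = ⊤)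
    -- `K(g,V)` is one-dimensional
    (R0 : V →ₗ[ℝ] V →ₗ[ℝ] (V →ₗ[ℝ] V)) (hR0 : IsCurv g R0) (hR0ne : R0 ≠ 0)
    (hKdim : ∀ R : V →ₗ[ℝ] V →ₗ[ℝ] (V →ₗ[ℝ] V), IsCurv g R → ∃ c : ℝ, R = c • R0)
    (T : AlternatingMap ℝ V ℝ (Fin 3)) (hTne : T ≠ 0)
    (TX : V → (V →ₗ[ℝ] V))
    (hTX : ∀ X Y Z : V, ⟪TX X Y, Z⟫ = T ![X, Y, Z])
    (hTg : ∀ X : V, TX X ∈ g) :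
    (∀ X Y : V, TX X ∘ₗ TX Y - TX Y ∘ₗ TX X = TX (TX X Y)) ∧
    (∀ A : V →ₗ[ℝ] V, A ∈ g ↔ ∃ X : V, A = TX X) := by
  have hadd : ∀ X X' Y : V, TX (X + X') Y = TX X Y + TX X' Y := by
    intro X X' Y
    refine ext_inner_right ℝ fun Z => ?_
    rw [inner_add_left, hTX, hTX, hTX]
    have h := T.map_update_add ![0, Y, Z] 0 X X'
    have hu : ∀ P : V, Function.update ![0, Y, Z] 0 P = ![P, Y, Z] := by
      intro P; ext i; fin_cases i <;> rfl
    rw [hu, hu, hu] at h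
    exact h
  have hsmul : ∀ (c : ℝ) (X Y : V), TX (c • X) Y = c • TX X Y := by
    intro c X Y
    refine ext_inner_right ℝ fun Z => ?_
    rw [inner_smul_left, hTX, hTX]
    have h := T.map_update_smul ![0, Y, Z] 0 c X
    have hu : ∀ P : V, Function.update ![0, Y, Z] 0 P = ![P, Y, Z] := by
      intro P; ext i; fin_cases i <;> rfl
    rw [hu, hu] at h
    simpa using h
  obtain ⟨U, hU⟩ : ∃ U : V →ₗ[ℝ] V →ₗ[ℝ] V, ∀ X, U X = TX X :=
    ⟨{ toFun := TX
       map_add' := fun X X' => LinearMap.ext fun Y => hadd X X' Y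
       map_smul' := fun c X => LinearMap.ext fun Y => hsmul c X Y }, fun _ => rfl⟩
  have hP : InP g U := by
    refine inP_of_self (fun X => hU X ▸ hTg X) fun X => ?_
    rw [hU]
    refine ext_inner_right ℝ fun Z => ?_
    rw [hTX, inner_zero_left]
    exact T.map_eq_zero_of_eq _ (i := 0) (j := 1) (by simp) (by decide)
  have hU0 : U ≠ 0 := by
    intro h
    apply hTne
    ext v
    have : v = ![v 0, v 1, v 2] := by ext i; fin_cases i <;> rfl
    rw [this, ← hTX, ← hU, h]
    simp
  have J : ∀ {U : V →ₗ[ℝ] V →ₗ[ℝ] V}, InP g U → ∀ W X Y, U W (U X Y) - U X (U W Y) = U (U W X) Y :=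
    fun h => jac hgskew hglie hirr R0 hR0 hR0ne hKdim h
  have hK := ker_R0 hglie hirr R0 hR0 hR0ne hKdim
  -- quadratic identity
  have Q : ∀ {S : V →ₗ[ℝ] V →ₗ[ℝ] V}, InP g S → ∃ c : ℝ, ∀ X Y Z, S Z (S X Y) = c • R0 X Y Z := by
    intro S hS
    obtain ⟨c, hc⟩ := hKdim _ (curvU_isCurv hglie hS)
    refine ⟨-(c / 3), fun X Y Z => ?_⟩
    have h1 := curvU_apply S X Y Z
    rw [hc, J hS] at h1
    simp only [LinearMap.smul_apply] at h1
    rw [hS.2 (S X Y) Z] at h1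
    have h2 : S Z (S X Y) = (-(1 / 3) : ℝ) • (c • R0 X Y Z) := by rw [h1]; module
    rw [h2]; module
  obtain ⟨t, ht⟩ := Q hP
  have ht0 : t ≠ 0 := by
    intro h
    apply hU0
    ext X Y
    have h1 := ht X Y X
    rw [h, zero_smul] at h1
    have h2 := hgskew _ (hP.1 X) (U X Y) Y
    rw [h1, inner_zero_left] at h2
    have : ⟪U X Y, U X Y⟫ = 0 := by linarith
    simpa using this
  have hinj : ∀ Y, U Y = 0 → Y = 0 := by
    intro Y hY
    apply hK
    intro X
    ext Z
    have := ht X Y Z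
    rw [hP.2 X Y, hY] at this
    simpa [ht0] using this.symm
  have hinj2 : ∀ Y, (∀ W, U W Y = 0) → Y = 0 := by
    intro Y hY
    apply hinj
    ext W
    rw [hP.2, hY]; simp
  -- the prolongation is one-dimensional
  have hdim : ∀ S, InP g S → ∃ s : ℝ, S = s • U := by
    intro S0 hS0
    obtain ⟨s1, hs1⟩ := Q hS0
    have hPadd : InP g (U + S0) := by
      refine ⟨fun X => g.add_mem (hP.1 X) (hS0.1 X), fun X Y => ?_⟩
      simp only [LinearMap.add_apply]
      rw [hP.2 X Y, hS0.2 X Y]; abel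
    obtain ⟨s2, hs2⟩ := Q hPadd
    obtain ⟨k, hk⟩ : ∃ k : ℝ, k = (s2 - s1 - t) / t / 2 := ⟨_, rfl⟩
    refine ⟨k, ?_⟩
    obtain ⟨S, hSdef⟩ : ∃ S, S = S0 - k • U := ⟨_, rfl⟩
    have hS : InP g S := by
      subst hSdef
      refine ⟨fun X => g.sub_mem (hS0.1 X) (g.smul_mem _ (hP.1 X)), fun X Y => ?_⟩
      simp only [LinearMap.sub_apply, LinearMap.smul_apply]
      rw [hP.2 X Y, hS0.2 X Y]; module
    have hmix : ∀ X Y Z, U X (S Y Z) = - S X (U Y Z) := by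
      intro X Y Z
      have e1 := ht Y Z X
      have e2 := hs1 Y Z X
      have e3 := hs2 Y Z X
      simp only [LinearMap.add_apply, map_add] at e3
      rw [e1, e2] at e3
      have e4 : U X (S0 Y Z) + S0 X (U Y Z) = (s2 - s1 - t) • R0 Y Z X := by
        have : U X (S0 Y Z) + S0 X (U Y Z) = (t • R0 Y Z X + S0 X (U Y Z) +
          (U X (S0 Y Z) + s1 • R0 Y Z X)) - s1 • R0 Y Z X - t • R0 Y Z X := by abel
        rw [this, e3]; module
      have e5 : (2 * k) • U X (U Y Z) = (s2 - s1 - t) • R0 Y Z X := by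
        rw [e1, smul_smul]; congr 1; rw [hk]; field_simp
      rw [hSdef, eq_neg_iff_add_eq_zero]
      simp only [LinearMap.sub_apply, LinearMap.smul_apply, map_sub, map_smul]
      have : U X (S0 Y Z) - k • U X (U Y Z) + (S0 X (U Y Z) - k • U X (U Y Z)) =
        (U X (S0 Y Z) + S0 X (U Y Z)) - (2 * k) • U X (U Y Z) := by module
      rw [this, e4, e5, sub_self]
    have r1 : ∀ X Y Z, U X (S Y Z) - U Y (S X Z) = - S (U X Y) Z := by
      intro X Y Z
      rw [← sub_eq_zero]
      apply hinj2
      intro W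
      have a1 : S W (U X (U Y Z)) = U W (U X (S Y Z)) := by
        rw [← neg_neg (S W _), ← hmix, hmix X Y Z, map_neg]
      have a2 : S W (U Y (U X Z)) = U W (U Y (S X Z)) := by
        rw [← neg_neg (S W _), ← hmix, hmix Y X Z, map_neg]
      have a3 := hmix W (U X Y) Z
      have a4 := congrArg (S W) (J hP X Y Z)
      rw [map_sub, a1, a2] at a4
      rw [map_sub, map_sub, map_neg, a3, a4]; abel
    have r2 : ∀ X Y Z, U X (S Y Z) - U Y (S X Z) = S (U X Y) Z := by
      intro X Y Z
      refine ext_inner_right ℝ fun N => ?_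
      have b := congrArg (fun v => ⟪Z, v⟫) (r1 X Y N)
      simp only [inner_sub_right, inner_neg_right] at b
      have c1 := hgskew _ (hS.1 (U X Y)) Z N
      have c2 := hgskew _ (hP.1 X) (S Y Z) N
      have c3 := hgskew _ (hS.1 Y) Z (U X N)
      have c4 := hgskew _ (hP.1 Y) (S X Z) N
      have c5 := hgskew _ (hS.1 X) Z (U Y N)
      have d1 := congrArg (fun v => ⟪Z, v⟫) (hmix X Y N)
      have d2 := congrArg (fun v => ⟪Z, v⟫) (hmix Y X N)
      simp only [inner_neg_right] at d1 d2
      rw [inner_sub_left]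
      linarith
    have r3 : ∀ X Y Z, S (U X Y) Z = 0 := by
      intro X Y Z
      have h1 := r1 X Y Z
      rw [r2] at h1
      have h2 : (2 : ℝ) • S (U X Y) Z = 0 := by rw [two_smul]; nth_rewrite 1 [h1]; simp
      simpa using h2
    have hS0' : S = 0 := by
      ext Z Y
      rw [LinearMap.zero_apply, LinearMap.zero_apply]
      apply hinj2
      intro W
      rw [hmix, hS.2, r3]; simp
    rw [hSdef, sub_eq_zero] at hS0'
    exact hS0'
  constructor
  · intro X Y
    ext Z
    simp only [← hU, LinearMap.sub_apply, LinearMap.comp_apply]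
    exact J hP X Y Z
  intro A
  constructor
  swap
  · rintro ⟨X, rfl⟩; exact hTg X
  intro hA
  obtain ⟨a, ha⟩ := hdim _ (act_inP hgskew hglie hP hA)
  obtain ⟨D, hD⟩ : ∃ D : V →ₗ[ℝ] V, D = A + a • LinearMap.id := ⟨_, rfl⟩
  have hder : ∀ X Y, D (U X Y) = U (D X) Y + U X (D Y) := by
    intro X Y
    have h1 := act_apply A U X Y
    rw [ha] at h1
    simp only [LinearMap.smul_apply] at h1
    have h2 : A (U X Y) = a • U X Y + U X (A Y) + U (A X) Y := by rw [h1]; abel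
    rw [hD]
    simp only [LinearMap.add_apply, LinearMap.smul_apply, LinearMap.id_apply, map_add, map_smul, h2]
    module
  -- the trace form
  let B : V →ₗ[ℝ] V →ₗ[ℝ] ℝ :=
    LinearMap.mk₂ ℝ (fun X Y => LinearMap.trace ℝ V (U X ∘ₗ U Y))
      (by intros; simp [LinearMap.add_comp]) (by intros; simp [LinearMap.smul_comp])
      (by intros; simp [LinearMap.comp_add]) (by intros; simp [LinearMap.comp_smul])
  have hB : ∀ X Y, B X Y = LinearMap.trace ℝ V (U X ∘ₗ U Y) := fun _ _ => rfl
  have hBnd : ∀ X, B X X = 0 → X = 0 := fun X hX =>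
    hinj X (trace_skew (hgskew _ (hP.1 X)) hX)
  have hBinj : Function.Injective B := by
    rw [← LinearMap.ker_eq_bot, LinearMap.ker_eq_bot']
    intro X hX
    exact hBnd X (by rw [hX]; simp)
  have hBsurj : Function.Surjective B :=
    (LinearMap.injective_iff_surjective_of_finrank_eq_finrank
      (Subspace.dual_finrank_eq (K := ℝ) (V := V)).symm).1 hBinj
  obtain ⟨W, hW⟩ := hBsurj
    ((LinearMap.trace ℝ V) ∘ₗ (LinearMap.mk₂ ℝ (fun X Y => D (U X Y))
      (by intros; simp) (by intros; simp) (by intros; simp) (by intros; simp)))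
  have hW' : ∀ X, LinearMap.trace ℝ V (U W ∘ₗ U X) = LinearMap.trace ℝ V (D ∘ₗ U X) := by
    intro X
    exact LinearMap.congr_fun hW X
  obtain ⟨E, hE⟩ : ∃ E : V →ₗ[ℝ] V, E = D - U W := ⟨_, rfl⟩
  have hEtr : ∀ X, LinearMap.trace ℝ V (E ∘ₗ U X) = 0 := by
    intro X
    rw [hE, LinearMap.sub_comp, map_sub, hW', sub_self]
  have hEder : ∀ X, E ∘ₗ U X - U X ∘ₗ E = U (E X) := by
    intro X
    ext Y
    have h1 := J hP W X Y
    rw [hE]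
    simp only [LinearMap.sub_apply, LinearMap.comp_apply, map_sub, hder, ← h1]
    abel
  have hE0 : E = 0 := by
    ext X
    apply hBnd
    obtain ⟨Y, hY⟩ : ∃ Y, Y = E X := ⟨_, rfl⟩
    rw [hB]
    nth_rewrite 1 [← hEder]
    rw [← hY, LinearMap.sub_comp, map_sub]
    have h1 : U (U X Y) = U X ∘ₗ U Y - U Y ∘ₗ U X := by
      ext Z; exact (J hP X Y Z).symm
    have h2 := hEtr (U X Y)
    rw [h1, LinearMap.comp_sub, map_sub] at h2
    have h3 : LinearMap.trace ℝ V ((U X ∘ₗ E) ∘ₗ U Y) = LinearMap.trace ℝ V (E ∘ₗ U Y ∘ₗ U X) := by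
      rw [LinearMap.comp_assoc]
      exact LinearMap.trace_mul_comm ℝ (U X) (E ∘ₗ U Y)
    rw [h3, LinearMap.comp_assoc]
    exact h2
  rw [hE, sub_eq_zero] at hE0
  refine ⟨W, ?_⟩
  rw [← hU, ← hE0, hD]
  -- a = 0
  ext X
  have s1 := hgskew _ hA X X
  have s2 := hgskew _ (hP.1 W) X X
  rw [← hE0, hD] at s2
  simp only [LinearMap.add_apply, LinearMap.smul_apply, LinearMap.id_apply, inner_add_left,
    inner_add_right, inner_smul_left, inner_smul_right, conj_trivial] at s2
  have s3 : a * ⟪X, X⟫ = 0 := by linarith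
  rcases mul_eq_zero.1 s3 with h | h
  · simp [h]
  · have : X = 0 := by simpa using h
    simp [this]
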